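/- If α and β are algebraic numbers with α ∉ {0, 1} and β irrational, then α^β is transcendental over ℚ. -/

import Mathlib

lemma exists_eq_sub_pow_mul_of_le_analyticOrderAt {f : ℂ → ℂ} (hf : Differentiable ℂ f) (s : ℂ)
    (r : ℕ) (h : (r : ℕ∞) ≤ analyticOrderAt f s) :
    ∃ g : ℂ → ℂ, Differentiable ℂ g ∧ ∀ z, f z = (z - s) ^ r * g z := by
  induction r generalizing f with
  | zero => exact ⟨f, hf, by simp⟩
  | succ r ih =>
    have hs : f s = 0 := by
      by_contra h0
      rw [(hf.analyticAt s).analyticOrderAt_eq_zero.2 h0] at h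
      simp at h
    have hd : Differentiable ℂ (dslope f s) := by
      rw [← differentiableOn_univ] at hf ⊢
      exact (Complex.differentiableOn_dslope Filter.univ_mem).2 hf
    have hfd : f = (fun z ↦ z - s) * dslope f s := by
      ext z
      simpa [hs] using (sub_smul_dslope f s z).symm
    have hid : AnalyticAt ℂ (fun z ↦ z - s) s := by fun_prop
    have hone : analyticOrderAt (fun z : ℂ ↦ z - s) s = 1 := by simp
    rw [hfd, analyticOrderAt_mul hid (hd.analyticAt s), hone, Nat.cast_succ, add_comm] at h
    obtain ⟨g, hg, hfg⟩ := ih hd ((ENat.add_le_add_iff_left (by simp)).1 h)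
    refine ⟨g, hg, fun z ↦ ?_⟩
    rw [hfd, Pi.mul_apply, hfg]
    ring

lemma exists_eq_prod_sub_pow_mul {f : ℂ → ℂ} (hf : Differentiable ℂ f) (S : Finset ℂ) (r : ℕ)
    (h : ∀ s ∈ S, (r : ℕ∞) ≤ analyticOrderAt f s) :
    ∃ g : ℂ → ℂ, Differentiable ℂ g ∧ ∀ z, f z = (∏ s ∈ S, (z - s) ^ r) * g z := by
  classical
  induction S using Finset.induction_on with
  | empty => exact ⟨f, hf, by simp⟩
  | insert a S ha ih =>
    obtain ⟨g, hg, hfg⟩ := ih fun s hs ↦ h s (Finset.mem_insert_of_mem hs)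
    have hP : AnalyticAt ℂ (fun z : ℂ ↦ ∏ s ∈ S, (z - s) ^ r) a := by fun_prop
    have hP0 : analyticOrderAt (fun z : ℂ ↦ ∏ s ∈ S, (z - s) ^ r) a = 0 := by
      rw [hP.analyticOrderAt_eq_zero, Finset.prod_ne_zero_iff]
      intro s hs
      exact pow_ne_zero _ (sub_ne_zero.2 fun e ↦ ha (e ▸ hs))
    have hfe : f = (fun z : ℂ ↦ ∏ s ∈ S, (z - s) ^ r) * g := funext hfg
    have := h a (Finset.mem_insert_self _ _)
    rw [hfe, analyticOrderAt_mul hP (hg.analyticAt a), hP0, zero_add] at this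
    obtain ⟨k, hk, hgk⟩ := exists_eq_sub_pow_mul_of_le_analyticOrderAt hg a r this
    refine ⟨k, hk, fun z ↦ ?_⟩
    rw [hfg, hgk, Finset.prod_insert ha]
    ring

/-- A Schwarz lemma for an entire function vanishing to order `r` at `0, 1, …, m - 1`. -/
lemma norm_le_of_iteratedDeriv_eq_zero {f : ℂ → ℂ} (hf : Differentiable ℂ f) {m r : ℕ}
    (h : ∀ t < m, ∀ k < r, iteratedDeriv k f t = 0) {R M : ℝ} (hR : m < R)
    (hM : ∀ z, ‖z‖ = R → ‖f z‖ ≤ M) {z : ℂ} (hz : ‖z‖ ≤ m) :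
    ‖f z‖ ≤ (2 * m) ^ (m * r) * (M / (R - m) ^ (m * r)) := by
  have hRm : 0 < R - m := sub_pos.2 hR
  have hcast : Set.InjOn (fun t : ℕ ↦ (t : ℂ)) (Finset.range m : Set ℕ) :=
    Nat.cast_injective.injOn
  have hm0 : (0 : ℝ) ≤ m := m.cast_nonneg
  obtain ⟨g, hg, hfg⟩ := exists_eq_prod_sub_pow_mul hf ((Finset.range m).image (Nat.cast)) r
    (by
      simp only [Finset.mem_image, Finset.mem_range, forall_exists_index, and_imp]
      rintro _ t ht rfl
      exact (natCast_le_analyticOrderAt_iff_iteratedDeriv_eq_zero (hf.analyticAt _)).2 (h t ht))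
  simp only [Finset.prod_image hcast] at hfg
  have hgR : ‖g z‖ ≤ M / (R - m) ^ (m * r) := by
    refine Complex.norm_le_of_forall_mem_frontier_norm_le (U := Metric.ball 0 R)
      Metric.isBounded_ball
      hg.diffContOnCl (fun w hw ↦ ?_) (subset_closure (by simpa using hz.trans_lt hR))
    rw [frontier_ball _ (hm0.trans_lt hR).ne', mem_sphere_zero_iff_norm] at hw
    rw [le_div_iff₀ (by positivity)]
    refine le_trans ?_ (hM w hw)
    rw [hfg, norm_mul, mul_comm, norm_prod]
    gcongr
    calc (R - m) ^ (m * r) = ∏ t ∈ Finset.range m, (R - m) ^ r := by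
          simp [← pow_mul, mul_comm]
      _ ≤ _ := by
          refine Finset.prod_le_prod (fun _ _ ↦ by positivity) fun t ht ↦ ?_
          rw [norm_pow]
          gcongr
          have h1 := norm_sub_norm_le w (t : ℂ)
          have h2 : (t : ℝ) ≤ m := by exact_mod_cast (Finset.mem_range.1 ht).le
          rw [hw, Complex.norm_natCast] at h1
          linarith
  rw [hfg, norm_mul, norm_prod]
  gcongr
  calc _ ≤ ∏ t ∈ Finset.range m, (2 * m : ℝ) ^ r := by
          refine Finset.prod_le_prod (fun _ _ ↦ by positivity) fun t ht ↦ ?_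
          rw [norm_pow]
          gcongr
          have h1 := norm_sub_le z (t : ℂ)
          have h2 : (t : ℝ) ≤ m := by exact_mod_cast (Finset.mem_range.1 ht).le
          rw [Complex.norm_natCast] at h1
          linarith
    _ = _ := by simp [← pow_mul, mul_comm]

open Complex Metric in
lemma norm_iteratedDeriv_le_of_iteratedDeriv_eq_zero {f : ℂ → ℂ} (hf : Differentiable ℂ f)
    {m r : ℕ} (h : ∀ t < m, ∀ k < r, iteratedDeriv k f t = 0) {R M : ℝ} (hR : m < R)
    (hM : ∀ z, ‖z‖ = R → ‖f z‖ ≤ M) {t : ℕ} (ht : t < m) :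
    ‖iteratedDeriv r f t‖ ≤ r.factorial * ((2 * m) ^ (m * r) * (M / (R - m) ^ (m * r))) := by
  have := norm_iteratedDeriv_le_of_forall_mem_sphere_norm_le (c := (t : ℂ)) (f := f) r one_pos
    hf.diffContOnCl (C := (2 * m) ^ (m * r) * (M / (R - m) ^ (m * r))) fun z hz ↦ by
      refine norm_le_of_iteratedDeriv_eq_zero hf h hR hM ?_
      rw [mem_sphere_iff_norm] at hz
      have h1 := norm_le_norm_add_norm_sub' z (t : ℂ)
      have h2 : (t : ℝ) + 1 ≤ m := by exact_mod_cast ht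
      rw [hz, Complex.norm_natCast] at h1
      linarith
  simpa using this

lemma iteratedDeriv_sum_mul_cexp {ι : Type*} [Fintype ι] (c ω : ι → ℂ) (k : ℕ) (z : ℂ) :
    iteratedDeriv k (fun z ↦ ∑ i, c i * Complex.exp (ω i * z)) z =
      ∑ i, c i * (ω i ^ k * Complex.exp (ω i * z)) := by
  rw [iteratedDeriv_fun_sum fun i _ ↦ by fun_prop]
  refine Finset.sum_congr rfl fun i _ ↦ ?_
  rw [iteratedDeriv_const_mul_field, iteratedDeriv_cexp_const_mul]

/-- An upper bound for a derivative of an exponential sum with many zeros. -/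
lemma norm_sum_mul_pow_mul_cexp_le {ι : Type*} [Fintype ι] (c ω : ι → ℂ) {m r : ℕ}
    (h : ∀ t < m, ∀ k < r, ∑ i, c i * (ω i ^ k * Complex.exp (ω i * (t : ℂ))) = 0)
    {R B W : ℝ} (hR : m < R) (hc : ∀ i, ‖c i‖ ≤ B) (hω : ∀ i, ‖ω i‖ ≤ W) {t : ℕ} (ht : t < m) :
    ‖∑ i, c i * (ω i ^ r * Complex.exp (ω i * (t : ℂ)))‖ ≤ r.factorial *
      ((2 * m) ^ (m * r) * ((Fintype.card ι * (B * Real.exp (W * R))) / (R - m) ^ (m * r))) := by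
  rw [← iteratedDeriv_sum_mul_cexp]
  refine norm_iteratedDeriv_le_of_iteratedDeriv_eq_zero (by fun_prop)
    (fun t ht k hk ↦ by rw [iteratedDeriv_sum_mul_cexp, h t ht k hk]) hR (fun z hz ↦ ?_) ht
  refine (norm_sum_le _ _).trans ?_
  rw [← nsmul_eq_mul]
  refine Finset.sum_le_card_nsmul _ _ _ fun i _ ↦ ?_
  rw [norm_mul]
  gcongr
  · exact (norm_nonneg _).trans (hc i)
  · exact hc i
  refine (Complex.norm_exp_le_exp_norm _).trans (Real.exp_le_exp.2 ?_)
  rw [norm_mul, hz]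
  gcongr
  · exact hz ▸ norm_nonneg z
  · exact hω i

open NumberField in
/-- Siegel's lemma over a number field with twice as many unknowns as equations. -/
lemma exists_siegel_bound (K : Type*) [Field K] [NumberField K] :
    ∃ C : ℝ, 1 ≤ C ∧ ∀ (ι κ : Type) [Fintype ι] [Fintype κ] (a : Matrix ι κ (𝓞 K)) (A : ℝ),
      0 < Fintype.card ι → Fintype.card κ = 2 * Fintype.card ι → 1 ≤ A →
      (∀ i j, house (a i j : K) ≤ A) →
      ∃ ξ : κ → 𝓞 K, ξ ≠ 0 ∧ a.mulVec ξ = 0 ∧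
        ∀ j, house (ξ j : K) ≤ C * (Fintype.card κ * A) := by
  classical
  have key : ∃ c : ℝ, ∀ (ι κ : Type) [Fintype ι] [Fintype κ] (a : Matrix ι κ (𝓞 K)) (A : ℝ),
      0 < Fintype.card ι → Fintype.card κ = 2 * Fintype.card ι → a ≠ 0 →
      (∀ i j, house (a i j : K) ≤ A) →
      ∃ ξ : κ → 𝓞 K, ξ ≠ 0 ∧ a.mulVec ξ = 0 ∧
        ∀ j, house (ξ j : K) ≤ c * ((c * Fintype.card κ * A) ^
          ((Fintype.card ι : ℝ) / (Fintype.card κ - Fintype.card ι))) := by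
    refine ⟨?_, fun ι κ _ _ a A hι hκ ha hA ↦ ?_⟩; rotate_left
    exact house.exists_ne_zero_int_vec_house_le K a ha hι (by lia) rfl hA rfl
  obtain ⟨c, hc⟩ := key
  refine ⟨max 1 (c ^ 2), le_max_left _ _, fun ι κ _ _ a A hι hκ hA1 hA ↦ ?_⟩
  have hκ0 : 0 < Fintype.card κ := by lia
  have hκ1 : (1 : ℝ) ≤ Fintype.card κ := by exact_mod_cast hκ0
  by_cases ha : a = 0
  · have : Nonempty κ := Fintype.card_pos_iff.1 hκ0
    refine ⟨1, one_ne_zero, by simp [ha], fun j ↦ ?_⟩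
    have h1 : house (((1 : κ → 𝓞 K) j : 𝓞 K) : K) = 1 := by
      simpa using house_intCast (K := K) 1
    rw [h1]
    exact one_le_mul_of_one_le_of_one_le (le_max_left _ _)
      (one_le_mul_of_one_le_of_one_le hκ1 hA1)
  · obtain ⟨ξ, h0, h1, h2⟩ := hc ι κ a A hι hκ ha hA
    refine ⟨ξ, h0, h1, fun j ↦ (h2 j).trans ?_⟩
    have hexp : (Fintype.card ι : ℝ) / (Fintype.card κ - Fintype.card ι) = 1 := by
      have : (Fintype.card ι : ℝ) ≠ 0 := by exact_mod_cast hι.ne'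
      rw [hκ]; push_cast; field_simp; ring
    rw [hexp, Real.rpow_one]
    calc c * (c * Fintype.card κ * A) = c ^ 2 * (Fintype.card κ * A) := by ring
      _ ≤ _ := by gcongr; exact le_max_right _ _

lemma eq_zero_of_forall_sum_mul_pow_eq_zero {ι R : Type*} [Fintype ι] [CommRing R] [IsDomain R]
    {c x : ι → R} (hx : Function.Injective x) (h : ∀ k : ℕ, ∑ i, c i * x i ^ k = 0) : c = 0 := by
  let e := (Fintype.equivFin ι).symm
  have := Matrix.eq_zero_of_forall_pow_sum_mul_pow_eq_zero (f := x ∘ e) (v := c ∘ e)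
    (hx.comp e.injective) fun k ↦ by
      rw [← h k]
      exact e.sum_comp fun i ↦ c i * x i ^ (k : ℕ)
  ext i
  simpa using congrFun this (e.symm i)

/-- The algebraic part of the `r`-th derivative at `t` of `exp ((a + b β) z log α)`, with its
denominators cleared: here `A = D α`, `B = D β` and `G = D α ^ β`. -/
def clearedDeriv {R : Type*} [CommRing R] (D A B G : R) (N r t a b : ℕ) : R :=
  (a * D + b * B) ^ r * ((A ^ (a * t) * D ^ (N - a * t)) * (G ^ (b * t) * D ^ (N - b * t)))

lemma map_clearedDeriv {R S : Type*} [CommRing R] [CommRing S] (f : R →+* S) (D A B G : R)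
    (N r t a b : ℕ) :
    f (clearedDeriv D A B G N r t a b) = clearedDeriv (f D) (f A) (f B) (f G) N r t a b := by
  simp [clearedDeriv]

lemma clearedDeriv_eq_exp {D β l : ℂ} {N t a b : ℕ} (r : ℕ) (ha : a * t ≤ N) (hb : b * t ≤ N) :
    clearedDeriv D (D * Complex.exp l) (D * β) (D * Complex.exp (β * l)) N r t a b =
      D ^ r * D ^ (2 * N) * ((a + b * β) ^ r * Complex.exp ((a + b * β) * l * t)) := by
  have hexp : Complex.exp ((a + b * β) * l * t) =
      Complex.exp l ^ (a * t) * Complex.exp (β * l) ^ (b * t) := by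
    rw [← Complex.exp_nat_mul, ← Complex.exp_nat_mul, ← Complex.exp_add]
    push_cast
    ring_nf
  have hD (j : ℕ) (hj : j ≤ N) : D ^ j * D ^ (N - j) = D ^ N := by
    rw [← pow_add, Nat.add_sub_cancel' hj]
  calc _ = D ^ r * (D ^ (a * t) * D ^ (N - a * t)) * (D ^ (b * t) * D ^ (N - b * t)) *
        ((a + b * β) ^ r * (Complex.exp l ^ (a * t) * Complex.exp (β * l) ^ (b * t))) := by
        rw [clearedDeriv, mul_pow, mul_pow, show (a * D + b * (D * β)) = D * (a + b * β) by ring,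
          mul_pow]
        ring
    _ = _ := by
        rw [hD _ ha, hD _ hb, hexp]
        ring

section House

open NumberField

variable {K : Type*} [Field K] [NumberField K]

lemma house_clearedDeriv_le {D A B G : K} {C : ℝ} (hC : 1 ≤ C) (hA : house A ≤ C)
    (hG : house G ≤ C) (hDB : house D + house B ≤ C) {N r t a b q : ℕ} (haq : a ≤ q)
    (hbq : b ≤ q) (ha : a * t ≤ N) (hb : b * t ≤ N) :
    house (clearedDeriv D A B G N r t a b) ≤ (q * C) ^ r * C ^ (2 * N) := by
  have hD : house D ≤ C := by linarith [house_nonneg B]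
  have hC0 : 0 ≤ C := zero_le_one.trans hC
  have hpow {x y : K} (hx : house x ≤ C) (hy : house y ≤ C) {j : ℕ} (hj : j ≤ N) :
      house (x ^ j * y ^ (N - j)) ≤ C ^ N := by
    calc house (x ^ j * y ^ (N - j)) ≤ house x ^ j * house y ^ (N - j) :=
          (house_mul_le _ _).trans (mul_le_mul (house_pow_le _ _) (house_pow_le _ _)
            (house_nonneg _) (pow_nonneg (house_nonneg _) _))
      _ ≤ C ^ j * C ^ (N - j) := by
          have := house_nonneg x
          have := house_nonneg y
          gcongr
      _ = C ^ N := by rw [← pow_add, Nat.add_sub_cancel' hj]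
  have hlin : house ((a : K) * D + b * B) ≤ q * C := by
    calc house ((a : K) * D + b * B) ≤ a * house D + b * house B := by
          refine (house_add_le _ _).trans_eq ?_
          rw [house_nat_mul, house_nat_mul]
      _ ≤ q * house D + q * house B := by
          gcongr <;> exact house_nonneg _
      _ ≤ q * C := by rw [← mul_add]; gcongr
  rw [two_mul, pow_add]
  refine (house_mul_le _ _).trans (mul_le_mul ?_ ?_ (house_nonneg _) (by positivity))
  · exact (house_pow_le _ _).trans (pow_le_pow_left₀ (house_nonneg _) hlin _)
  · exact (house_mul_le _ _).trans
      (mul_le_mul (hpow hA hD ha) (hpow hG hD hb) (house_nonneg _) (by positivity))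

lemma one_le_norm_mul_house_pow (σ : K →+* ℂ) {ρ : 𝓞 K} (hρ : ρ ≠ 0) :
    1 ≤ ‖σ ρ‖ * house (ρ : K) ^ (Module.finrank ℚ K - 1) := by
  refine le_trans ?_ (norm_norm_le_norm_mul_house_pow (ρ : K) σ)
  rw [← Algebra.coe_norm_int, ← Rat.norm_cast_real, Rat.cast_intCast, Real.norm_eq_abs]
  exact_mod_cast Int.one_le_abs ((Algebra.norm_ne_zero_iff (R := ℤ)).2 hρ)

/-- The coefficients of the auxiliary function, together with the first derivative of it which
does not vanish at all of the points `0, …, m - 1`. -/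
lemma exists_auxiliary_coeffs {C : ℝ} (hC1 : 1 ≤ C)
    (hC : ∀ (ι κ : Type) [Fintype ι] [Fintype κ] (a : Matrix ι κ (𝓞 K)) (A : ℝ),
      0 < Fintype.card ι → Fintype.card κ = 2 * Fintype.card ι → 1 ≤ A →
      (∀ i j, house (a i j : K) ≤ A) →
      ∃ ξ : κ → 𝓞 K, ξ ≠ 0 ∧ a.mulVec ξ = 0 ∧
        ∀ j, house (ξ j : K) ≤ C * (Fintype.card κ * A))
    {D A B G : 𝓞 K} (hD0 : D ≠ 0) (hA : house (A : K) ≤ C)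
    (hG : house (G : K) ≤ C) (hDB : house (D : K) + house (B : K) ≤ C)
    (hinj : ∀ a b a' b' : ℕ, (a * D + b * B : 𝓞 K) = a' * D + b' * B → a = a' ∧ b = b')
    {m n q : ℕ} (hm : 0 < m) (hn : 0 < n) (hq : 0 < q) (hqn : q ^ 2 = 2 * (m * n)) :
    ∃ η : Fin q × Fin q → 𝓞 K,
      (∀ p, house (η p : K) ≤ C * (q ^ 2 * ((q * C) ^ n * C ^ (2 * (q * m))))) ∧
      ∃ r ≥ n,
        (∃ t < m, ∑ p, η p * clearedDeriv D A B G (q * m) r t p.1 p.2 ≠ 0) ∧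
        ∀ t < m, ∀ k < r, ∑ p, η p * clearedDeriv D A B G (q * m) k t p.1 p.2 = 0 := by
  have hle {i t : ℕ} (hi : i < q) (ht : t < m) : i * t ≤ q * m := Nat.mul_le_mul hi.le ht.le
  have hqC : 1 ≤ q * C := one_le_mul_of_one_le_of_one_le (by exact_mod_cast hq) hC1
  have hcard : Fintype.card (Fin q × Fin q) = q ^ 2 := by simp [sq]
  obtain ⟨η, hη0, hη, hηC⟩ := hC (Fin m × Fin n) (Fin q × Fin q)
    (fun i p ↦ clearedDeriv D A B G (q * m) i.2 i.1 p.1 p.2) ((q * C) ^ n * C ^ (2 * (q * m)))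
    (by simp [hm, hn]) (by rw [hcard, hqn]; simp)
    (one_le_mul_of_one_le_of_one_le (one_le_pow₀ hqC) (one_le_pow₀ hC1)) fun i p ↦ by
      rw [show ((clearedDeriv D A B G (q * m) i.2 i.1 p.1 p.2 : 𝓞 K) : K) = _ from
        map_clearedDeriv (algebraMap (𝓞 K) K) ..]
      refine (house_clearedDeriv_le hC1 hA hG hDB p.1.2.le p.2.2.le (hle p.1.2 i.1.2)
        (hle p.2.2 i.1.2)).trans ?_
      gcongr
      · exact i.2.2.le
  rw [hcard, Nat.cast_pow] at hηC
  refine ⟨η, hηC, ?_⟩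
  have hex : ∃ r, ∃ t < m, ∑ p, η p * clearedDeriv D A B G (q * m) r t p.1 p.2 ≠ 0 := by
    by_contra! h
    refine hη0 ?_
    have hzero := eq_zero_of_forall_sum_mul_pow_eq_zero
      (c := fun p ↦ η p * (D ^ (q * m) * D ^ (q * m)))
      (x := fun p : Fin q × Fin q ↦ ((p.1 : ℕ) * D + (p.2 : ℕ) * B : 𝓞 K))
      (fun p p' hp ↦ by
        have := hinj _ _ _ _ hp
        exact Prod.ext (Fin.ext this.1) (Fin.ext this.2))
      (fun k ↦ by
        rw [← h k 0 hm]
        refine Finset.sum_congr rfl fun p _ ↦ ?_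
        simp only [clearedDeriv, mul_zero, pow_zero, Nat.sub_zero, one_mul]
        ring)
    ext1 p
    have := congrFun hzero p
    simpa [hD0] using this
  classical
  refine ⟨Nat.find hex, ?_, Nat.find_spec hex, fun t ht k hk ↦ ?_⟩
  · by_contra! hlt
    obtain ⟨t, ht, h⟩ := Nat.find_spec hex
    refine h ?_
    have := congrFun hη (⟨t, ht⟩, ⟨Nat.find hex, hlt⟩)
    simpa [Matrix.mulVec, dotProduct, mul_comm] using this
  · have := Nat.find_min hex hk
    push Not at this
    exact this t ht

end House

section Estimates

/-- The growth estimates below share these relations between the parameters. -/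
structure ParamBounds (m q r : ℕ) : Prop where
  m_pos : 0 < m
  q_pos : 0 < q
  r_pos : 0 < r
  sq_le : q ^ 2 ≤ 2 * m * r
  two_mul_le : 2 * m ≤ q

namespace ParamBounds

variable {m q r : ℕ} (h : ParamBounds m q r)
include h

lemma sq_le_pow : (q : ℝ) ^ 2 ≤ (4 * m) ^ r := by
  have h1 : r ≤ 2 ^ r := Nat.lt_two_pow_self.le
  have h2 : 2 * m ≤ (2 * m) ^ r := Nat.le_self_pow h.r_pos.ne' _
  have : q ^ 2 ≤ (4 * m) ^ r := by
    calc q ^ 2 ≤ 2 * m * r := h.sq_le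
      _ ≤ (2 * m) ^ r * 2 ^ r := by gcongr
      _ = (4 * m) ^ r := by rw [← mul_pow]; ring_nf
  exact_mod_cast this

lemma mul_le_mul : q * m ≤ m * r := by
  have := h.sq_le
  have := h.two_mul_le
  nlinarith

lemma pow_le {C : ℝ} (hC : 1 ≤ C) : C ^ (2 * (q * m)) ≤ (C ^ (2 * m)) ^ r := by
  rw [← pow_mul]
  refine pow_le_pow_right₀ hC ?_
  linarith [h.mul_le_mul]

lemma coeff_le {C : ℝ} (hC : 1 ≤ C) {n : ℕ} (hn : n ≤ r) :
    C * (q ^ 2 * ((q * C) ^ n * C ^ (2 * (q * m)))) ≤ (4 * m * C ^ (2 + 2 * m) * q) ^ r := by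
  have hqC : 1 ≤ q * C := one_le_mul_of_one_le_of_one_le (by exact_mod_cast h.q_pos) hC
  calc C * (q ^ 2 * ((q * C) ^ n * C ^ (2 * (q * m))))
      ≤ C ^ r * ((4 * m) ^ r * ((q * C) ^ r * (C ^ (2 * m)) ^ r)) := by
        gcongr
        · exact le_self_pow₀ hC h.r_pos.ne'
        · exact h.sq_le_pow
        · exact h.pow_le hC
    _ = _ := by
        simp only [← mul_pow]
        ring_nf

lemma house_bound_le {C : ℝ} (hC : 1 ≤ C) {n : ℕ} (hn : n ≤ r) :
    q ^ 2 * (C * (q ^ 2 * ((q * C) ^ n * C ^ (2 * (q * m)))) *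
      ((q * C) ^ r * C ^ (2 * (q * m)))) ≤
      (32 * m ^ 3 * C ^ (3 + 4 * m) * r) ^ r := by
  have hsq : (q : ℝ) ^ 2 ≤ 2 * m * r := by exact_mod_cast h.sq_le
  calc _ ≤ (4 * m : ℝ) ^ r * ((4 * m * C ^ (2 + 2 * m) * q) ^ r *
        ((q * C) ^ r * (C ^ (2 * m)) ^ r)) := by
        gcongr
        · exact h.sq_le_pow
        · exact h.coeff_le hC hn
        · exact h.pow_le hC
    _ = (16 * m ^ 2 * C ^ (3 + 4 * m) * q ^ 2) ^ r := by
        simp only [← mul_pow]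
        ring_nf
    _ ≤ (16 * m ^ 2 * C ^ (3 + 4 * m) * (2 * m * r)) ^ r := by
        gcongr
    _ = _ := by ring_nf

lemma div_pow_le {m' : ℕ} (hm' : m = 2 * m') :
    1 / ((r : ℝ) / q) ^ (m * r) ≤ ((2 * m / r) ^ m') ^ r := by
  have hsq : (q : ℝ) ^ 2 ≤ 2 * m * r := by exact_mod_cast h.sq_le
  have hr : (0 : ℝ) < r := by exact_mod_cast h.r_pos
  calc 1 / ((r : ℝ) / q) ^ (m * r) = ((q ^ 2 / r ^ 2) ^ m') ^ r := by
        rw [one_div, ← inv_pow, inv_div, ← div_pow, ← pow_mul, ← pow_mul, hm', mul_assoc]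
    _ ≤ ((2 * m * r / r ^ 2) ^ m') ^ r := by gcongr
    _ = _ := by
        congr 2
        field_simp

lemma value_bound_le {C L W : ℝ} (hC : 1 ≤ C) (hL : 0 ≤ L) (hW : 0 ≤ W) {n m' : ℕ} (hn : n ≤ r)
    (hm' : m = 2 * m') :
    C ^ r * C ^ (2 * (q * m)) * (L ^ r * (r.factorial * ((2 * m) ^ (m * r) *
      (q ^ 2 * (C * (q ^ 2 * ((q * C) ^ n * C ^ (2 * (q * m)))) *
        Real.exp (q * W * (m + r / q))) / (m + r / q - m) ^ (m * r))))) ≤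
      (32 * m ^ 3 * C ^ (3 + 4 * m) * L * (2 * m) ^ m * Real.exp (W * (m + 1)) *
        (2 * m) ^ m' * (r ^ 2 / r ^ m')) ^ r := by
  have hsq : (q : ℝ) ^ 2 ≤ 2 * m * r := by exact_mod_cast h.sq_le
  have hq1 : (1 : ℝ) ≤ q := by exact_mod_cast h.q_pos
  have hr : (0 : ℝ) < r := by exact_mod_cast h.r_pos
  have hqr : (q : ℝ) ≤ 2 * m * r := le_trans (by nlinarith) hsq
  have hfac : (r.factorial : ℝ) ≤ r ^ r := by exact_mod_cast Nat.factorial_le_pow r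
  have hexp : Real.exp (q * W * (m + r / q)) ≤ Real.exp (W * (m + 1)) ^ r := by
    rw [← Real.exp_nat_mul, Real.exp_le_exp]
    have : (q * m : ℝ) ≤ m * r := by exact_mod_cast h.mul_le_mul
    calc q * W * (m + r / q) = W * (q * m + r) := by field_simp
      _ ≤ W * (m * r + r) := by gcongr
      _ = _ := by ring
  have hE : (0 : ℝ) ≤ 4 * m * C ^ (2 + 2 * m) := by positivity
  calc _ = C ^ r * C ^ (2 * (q * m)) * (L ^ r * (r.factorial * (((2 * m) ^ m) ^ r *
        (q ^ 2 * (C * (q ^ 2 * ((q * C) ^ n * C ^ (2 * (q * m)))) *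
          Real.exp (q * W * (m + r / q))) * (1 / (r / q : ℝ) ^ (m * r)))))) := by
        rw [add_sub_cancel_left, ← pow_mul, mul_one_div]
    _ ≤ C ^ r * (C ^ (2 * m)) ^ r * (L ^ r * (r ^ r * (((2 * m) ^ m) ^ r *
        ((4 * m) ^ r * ((4 * m * C ^ (2 + 2 * m) * (2 * m * r)) ^ r *
          Real.exp (W * (m + 1)) ^ r) * ((2 * m / r) ^ m') ^ r)))) := by
        gcongr
        · exact h.pow_le hC
        · exact h.sq_le_pow
        · exact (h.coeff_le hC hn).trans (by gcongr)
        · exact h.div_pow_le hm'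
    _ = _ := by
        simp only [← mul_pow, div_pow]
        ring_nf

end ParamBounds

lemma le_of_one_le_mul_pow {x y E₁ E₂ : ℝ} {d r : ℕ} (hd : 0 < d) (hr : 0 < r) (hE₁ : 0 ≤ E₁)
    (hE₂ : 0 ≤ E₂)
    (hy0 : 0 ≤ y) (hxy : 1 ≤ x * y ^ (d - 1)) (hy : y ≤ (E₁ * r) ^ r)
    (hx : x ≤ (E₂ * (r ^ 2 / r ^ (d + 2))) ^ r) : (r : ℝ) ≤ E₂ * E₁ ^ (d - 1) := by
  have hr0 : (0 : ℝ) < r := by exact_mod_cast hr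
  obtain ⟨d, rfl⟩ := Nat.exists_eq_add_of_lt hd
  simp only [zero_add, Nat.add_sub_cancel] at *
  have h1 : 1 ≤ (E₂ * E₁ ^ d / r) ^ r := by
    calc 1 ≤ x * y ^ d := hxy
      _ ≤ (E₂ * (r ^ 2 / r ^ (d + 1 + 2))) ^ r * ((E₁ * r) ^ r) ^ d := by gcongr
      _ = (E₂ * E₁ ^ d / r) ^ r := by
        rw [pow_right_comm, ← mul_pow]
        congr 1
        field_simp
        ring
  by_contra! hlt
  exact h1.not_gt (pow_lt_one₀ (by positivity) ((div_lt_one hr0).2 hlt) hr.ne')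

end Estimates

section Main

open NumberField

variable {K : Type*} [Field K] [NumberField K]

lemma norm_map_sum_clearedDeriv_le {C : ℝ} (hC : 1 ≤ C) (σ : K →+* ℂ) {D A B G : 𝓞 K} {β l : ℂ}
    (hl : l ≠ 0) (hD0 : D ≠ 0) (hD : ‖σ D‖ ≤ C) (hA : σ A = σ D * Complex.exp l)
    (hB : σ B = σ D * β) (hG : σ G = σ D * Complex.exp (β * l)) {m q r : ℕ}
    (h : ParamBounds m q r) {H : ℝ} {η : Fin q × Fin q → 𝓞 K} (hη : ∀ p, house (η p : K) ≤ H)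
    (hzero : ∀ t < m, ∀ k < r, ∑ p, η p * clearedDeriv D A B G (q * m) k t p.1 p.2 = 0)
    {t : ℕ} (ht : t < m) :
    ‖σ ((∑ p, η p * clearedDeriv D A B G (q * m) r t p.1 p.2 : 𝓞 K) : K)‖ ≤
      C ^ r * C ^ (2 * (q * m)) * (‖l‖⁻¹ ^ r * (r.factorial * ((2 * m) ^ (m * r) *
        (q ^ 2 * (H * Real.exp (q * ((1 + ‖β‖) * ‖l‖) * (m + r / q))) /
          (m + r / q - m) ^ (m * r))))) := by
  have hσD : σ D ≠ 0 := by simpa using hD0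
  have hl0 : 0 < ‖l‖ := norm_pos_iff.2 hl
  let ω : Fin q × Fin q → ℂ := fun p ↦ ((p.1 : ℕ) + (p.2 : ℕ) * β) * l
  have hval (k : ℕ) {t : ℕ} (ht : t < m) :
      σ ((∑ p, η p * clearedDeriv D A B G (q * m) k t p.1 p.2 : 𝓞 K) : K) * l ^ k =
        σ D ^ k * σ D ^ (2 * (q * m)) *
          ∑ p, σ (η p) * (ω p ^ k * Complex.exp (ω p * t)) := by
    have hle (i : Fin q) : i * t ≤ q * m := Nat.mul_le_mul i.2.le ht.le
    have hcast (x : 𝓞 K) : σ x = (σ.comp (algebraMap (𝓞 K) K)) x := rfl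
    rw [hcast, map_sum, Finset.sum_mul, Finset.mul_sum]
    refine Finset.sum_congr rfl fun p _ ↦ ?_
    rw [map_mul, map_clearedDeriv, ← hcast, ← hcast, ← hcast, ← hcast, ← hcast, hA, hB, hG,
      clearedDeriv_eq_exp k (hle p.1) (hle p.2)]
    simp only [ω, mul_pow]
    ring
  have hq : (0 : ℝ) < q := by exact_mod_cast h.q_pos
  have hr : (0 : ℝ) < r := by exact_mod_cast h.r_pos
  have hsum := norm_sum_mul_pow_mul_cexp_le (fun p ↦ σ (η p)) ω (m := m) (r := r)
    (R := m + r / q) (B := H) (W := q * ((1 + ‖β‖) * ‖l‖))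
    (fun t ht k hk ↦ by
      have := hval k ht
      rw [hzero t ht k hk] at this
      simpa [hσD] using this.symm)
    (lt_add_of_pos_right _ (by positivity))
    (fun p ↦ (norm_embedding_le_house _ _).trans (hη p))
    (fun p ↦ by
      have h1 : ((p.1 : ℕ) : ℝ) ≤ q := by exact_mod_cast p.1.2.le
      have h2 : ((p.2 : ℕ) : ℝ) ≤ q := by exact_mod_cast p.2.2.le
      rw [norm_mul, ← mul_assoc]
      gcongr
      refine (norm_add_le _ _).trans ?_
      rw [norm_mul, Complex.norm_natCast, Complex.norm_natCast, mul_add, mul_one]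
      gcongr) ht
  rw [Fintype.card_prod, Fintype.card_fin, Nat.cast_mul, ← sq] at hsum
  rw [(eq_div_iff (pow_ne_zero r hl)).2 (hval r ht), div_eq_mul_inv, mul_assoc,
    mul_comm (∑ p, _), norm_mul, norm_mul, norm_mul, norm_inv, norm_pow, norm_pow, norm_pow,
    ← inv_pow]
  gcongr

theorem false_of_exp_mem_numberField (σ : K →+* ℂ) {α β γ : K} {l : ℂ} (hl : l ≠ 0)
    (hα : σ α = Complex.exp l) (hγ : σ γ = Complex.exp (σ β * l)) (hβ : ∀ x : ℚ, β ≠ x) :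
    False := by
  classical
  obtain ⟨y, hy0, hy⟩ := exists_integral_multiples ℤ ℚ ({α, β, γ} : Finset K)
  obtain ⟨C₀, hC₀, hsiegel⟩ := exists_siegel_bound K
  let D : 𝓞 K := (y : 𝓞 K)
  have hDK : (D : K) = y := by simp [D]
  have hmul {x : K} (hx : x ∈ ({α, β, γ} : Finset K)) : ∃ X : 𝓞 K, (X : K) = D * x :=
    ⟨⟨y • x, hy x hx⟩, by rw [hDK]; exact zsmul_eq_mul _ _⟩
  obtain ⟨A, hA⟩ := hmul (x := α) (by simp)
  obtain ⟨B, hB⟩ := hmul (x := β) (by simp)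
  obtain ⟨G, hG⟩ := hmul (x := γ) (by simp)
  have hD0 : D ≠ 0 := by simpa [D] using hy0
  have hDK0 : (D : K) ≠ 0 := by simpa using hD0
  obtain ⟨C, hCC₀, hCA, hCG, hCDB⟩ : ∃ C, C₀ ≤ C ∧ house (A : K) ≤ C ∧ house (G : K) ≤ C ∧
      house (D : K) + house (B : K) ≤ C := by
    refine ⟨C₀ + house (A : K) + house (G : K) + (house (D : K) + house (B : K)), ?_⟩
    have := house_nonneg (A : K)
    have := house_nonneg (B : K)
    have := house_nonneg (D : K)
    have := house_nonneg (G : K)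
    refine ⟨?_, ?_, ?_, ?_⟩ <;> linarith
  have hC1 : 1 ≤ C := hC₀.trans hCC₀
  have hinj (a b a' b' : ℕ) (hab : (a * D + b * B : 𝓞 K) = a' * D + b' * B) :
      a = a' ∧ b = b' := by
    have hK : (a + b * β : K) = a' + b' * β := by
      refine mul_left_cancel₀ hDK0 ?_
      have := congrArg (algebraMap (𝓞 K) K) hab
      simp only [map_add, map_mul, map_natCast, hB] at this
      linear_combination this
    by_cases hb : b = b'
    · subst hb
      exact ⟨by exact_mod_cast add_right_cancel hK, rfl⟩
    · refine (hβ ((a' - a) / (b - b')) ?_).elim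
      have hb' : (b - b' : K) ≠ 0 := sub_ne_zero.2 (by exact_mod_cast hb)
      push_cast
      rw [eq_div_iff hb']
      linear_combination hK
  set d := Module.finrank ℚ K
  have hd0 : 0 < d := Module.finrank_pos
  obtain ⟨m, hm⟩ : ∃ m, m = 2 * (d + 2) := ⟨_, rfl⟩
  have hm0 : 0 < m := by lia
  set W := (1 + ‖σ β‖) * ‖l‖
  set E₁ : ℝ := 32 * m ^ 3 * C ^ (3 + 4 * m)
  set E₂ : ℝ := 32 * m ^ 3 * C ^ (3 + 4 * m) * ‖l‖⁻¹ * (2 * m) ^ m * Real.exp (W * (m + 1)) *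
    (2 * m) ^ (d + 2)
  obtain ⟨k, hk⟩ := exists_nat_gt (E₂ * E₁ ^ (d - 1))
  have hk0 : 0 < k := by
    have : (0 : ℝ) < k := lt_of_le_of_lt (by positivity) hk
    exact_mod_cast this
  obtain ⟨q, hq⟩ : ∃ q, q = 2 * m * k := ⟨_, rfl⟩
  have hq0 : 0 < q := by rw [hq]; positivity
  obtain ⟨η, hη, r, hr, ⟨t, ht, hρ⟩, hzero⟩ := exists_auxiliary_coeffs hC1
    (fun ι κ _ _ a X h1 h2 h3 h4 ↦ by
      obtain ⟨ξ, h5, h6, h7⟩ := hsiegel ι κ a X h1 h2 h3 h4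
      exact ⟨ξ, h5, h6, fun j ↦ (h7 j).trans (by gcongr)⟩)
    hD0 hCA hCG hCDB hinj (m := m) (n := 2 * m * k ^ 2) (q := q) hm0
    (by positivity) hq0 (by rw [hq]; ring)
  have hkr : k ≤ r := le_trans (by nlinarith) hr
  have hp : ParamBounds m q r := by
    refine ⟨hm0, hq0, hk0.trans_le hkr, ?_, hq ▸ Nat.le_mul_of_pos_right _ hk0⟩
    calc q ^ 2 = 2 * m * (2 * m * k ^ 2) := by rw [hq]; ring
      _ ≤ _ := by gcongr
  have hle {i : Fin q} : i * t ≤ q * m := Nat.mul_le_mul i.2.le ht.le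
  have hhouse : house ((∑ p, η p * clearedDeriv D A B G (q * m) r t p.1 p.2 : 𝓞 K) : K) ≤
      (E₁ * r) ^ r := by
    refine le_trans ?_ (hp.house_bound_le hC1 hr)
    have hcast (x : 𝓞 K) : (x : K) = algebraMap (𝓞 K) K x := rfl
    rw [hcast, map_sum]
    refine (house_sum_le_sum_house _ _).trans ((Finset.sum_le_card_nsmul _ _
      (C * (q ^ 2 * ((q * C) ^ (2 * m * k ^ 2) * C ^ (2 * (q * m)))) *
        ((q * C) ^ r * C ^ (2 * (q * m)))) fun p _ ↦ ?_).trans_eq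
      (by simp only [Finset.card_univ, Fintype.card_prod, Fintype.card_fin, nsmul_eq_mul]
          push_cast
          ring))
    rw [map_mul, map_clearedDeriv]
    exact (house_mul_le _ _).trans (mul_le_mul (hη p)
      (house_clearedDeriv_le hC1 hCA hCG hCDB p.1.2.le p.2.2.le hle hle) (house_nonneg _)
      ((house_nonneg _).trans (hη p)))
  have hnorm := (norm_map_sum_clearedDeriv_le hC1 σ hl hD0
    ((norm_embedding_le_house _ _).trans (by linarith [house_nonneg (B : K)]))
    (by rw [hA, map_mul, hα]) (by rw [hB, map_mul]) (by rw [hG, map_mul, hγ]) hp hη hzero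
    ht).trans (hp.value_bound_le hC1 (by positivity) (by positivity) hr hm)
  have := le_of_one_le_mul_pow hd0 hp.r_pos (by positivity) (by positivity) (house_nonneg _)
    (one_le_norm_mul_house_pow σ hρ) hhouse hnorm
  have hkr' : (k : ℝ) ≤ r := by exact_mod_cast hkr
  linarith

end Main

/-- Gelfond–Schneider: if `α` and `β` are algebraic numbers with `α ∉ {0, 1}` and `β`
irrational, then `α ^ β = exp (β log α)` is transcendental over `ℚ`. -/
theorem gelfond_schneider (α β : ℂ) (hα : IsAlgebraic ℚ α) (hβ : IsAlgebraic ℚ β)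
    (hα0 : α ≠ 0) (hα1 : α ≠ 1) (hβirr : β ∉ Set.range ((↑) : ℚ → ℂ)) :
    Transcendental ℚ (Complex.exp (β * Complex.log α)) := by
  intro hγ
  have hKα : α ∈ IntermediateField.adjoin ℚ {α, β, Complex.exp (β * Complex.log α)} :=
    IntermediateField.subset_adjoin _ _ (by simp)
  have hKβ : β ∈ IntermediateField.adjoin ℚ {α, β, Complex.exp (β * Complex.log α)} :=
    IntermediateField.subset_adjoin _ _ (by simp)
  have hKγ : Complex.exp (β * Complex.log α) ∈
      IntermediateField.adjoin ℚ {α, β, Complex.exp (β * Complex.log α)} :=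
    IntermediateField.subset_adjoin _ _ (by simp)
  have hfin : FiniteDimensional ℚ
      (IntermediateField.adjoin ℚ {α, β, Complex.exp (β * Complex.log α)}) := by
    refine IntermediateField.finiteDimensional_adjoin fun x hx ↦ ?_
    simp only [Set.mem_insert_iff, Set.mem_singleton_iff] at hx
    rcases hx with rfl | rfl | rfl
    exacts [hα.isIntegral, hβ.isIntegral, hγ.isIntegral]
  have : NumberField (IntermediateField.adjoin ℚ {α, β, Complex.exp (β * Complex.log α)}) :=
    { to_charZero := inferInstance
      to_finiteDimensional := hfin }
  refine false_of_exp_mem_numberField (algebraMap _ ℂ)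
    (α := (⟨α, hKα⟩ : IntermediateField.adjoin ℚ {α, β, Complex.exp (β * Complex.log α)}))
    (β := ⟨β, hKβ⟩) (γ := ⟨_, hKγ⟩) (l := Complex.log α) ?_ (Complex.exp_log hα0).symm rfl ?_
  · intro h
    refine hα1 ?_
    rw [← Complex.exp_log hα0, h, Complex.exp_zero]
  · intro x hx
    refine hβirr ⟨x, ?_⟩
    simpa using (congrArg Subtype.val hx).symm
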